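/- Let Ψ be an Orlicz function, (Ω,P) a probability space, and (f_n) a sequence in L^Ψ such that for some M > 0 one has ‖∑_{n=1}^N ε_n f_n‖_Ψ ≤ M for every N ≥ 1 and every choice of signs ε_n = ±1. Then ∫_Ω Ψ((1/(M√2)) (∑_{n=1}^∞ |f_n|²)^{1/2}) dP ≤ 1; in particular f_n → 0 almost everywhere and ∫_Ω Ψ(|f_n|/(M√2)) dP → 0 as n → ∞. -/

import Mathlib

open MeasureTheory Filter Set Topology ENNReal NNReal

noncomputable section

/-- An Orlicz function: non-decreasing, convex (indeed strictly convex), vanishing and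
continuous at `0`, with `Ψ x / x → ∞` as `x → ∞`. (We regard it as a function `ℝ → ℝ`,
only its values on `[0,∞)` being relevant.) -/
structure IsOrliczFunction (Ψ : ℝ → ℝ) : Prop where
  map_zero : Ψ 0 = 0
  nonneg : ∀ x, 0 ≤ Ψ x
  mono : MonotoneOn Ψ (Set.Ici (0 : ℝ))
  strictConvexOn : StrictConvexOn ℝ (Set.Ici (0 : ℝ)) Ψ
  continuousWithinAt_zero : ContinuousWithinAt Ψ (Set.Ici (0 : ℝ)) 0
  tendsto_div_atTop : Tendsto (fun x => Ψ x / x) atTop atTop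

/-- The Orlicz modular `∫ Ψ(|f|/C) dμ` (as an extended nonneg real). -/
def orliczModular {Ω : Type*} [MeasurableSpace Ω] (Ψ : ℝ → ℝ) (μ : Measure Ω)
    (f : Ω → ℂ) (C : ℝ) : ℝ≥0∞ :=
  ∫⁻ ω, ENNReal.ofReal (Ψ (‖f ω‖ / C)) ∂μ

/-- The Luxemburg norm. -/
def luxNorm {Ω : Type*} [MeasurableSpace Ω] (Ψ : ℝ → ℝ) (μ : Measure Ω) (f : Ω → ℂ) : ℝ :=
  sInf {C : ℝ | 0 < C ∧ orliczModular Ψ μ f C ≤ 1}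

/-- Membership in the Orlicz space `L^Ψ`. -/
def MemOrlicz {Ω : Type*} [MeasurableSpace Ω] (Ψ : ℝ → ℝ) (μ : Measure Ω) (f : Ω → ℂ) : Prop :=
  AEStronglyMeasurable f μ ∧ ∃ C > 0, orliczModular Ψ μ f C < ⊤

/-- Membership in the Morse–Transue space `M^Ψ` (the closure of `L^∞` in `L^Ψ`). -/
def MemMorseTransue {Ω : Type*} [MeasurableSpace Ω] (Ψ : ℝ → ℝ) (μ : Measure Ω)
    (f : Ω → ℂ) : Prop :=
  AEStronglyMeasurable f μ ∧ ∀ C > 0, orliczModular Ψ μ f C < ⊤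

/-- A subspace `X` is closed (in the Luxemburg norm) in the Morse–Transue space. -/
def IsLuxClosedIn {Ω : Type*} [MeasurableSpace Ω] (Ψ : ℝ → ℝ) (μ : Measure Ω)
    (X : Submodule ℂ (Ω → ℂ)) : Prop :=
  ∀ f : Ω → ℂ, MemMorseTransue Ψ μ f →
    (∀ ε > 0, ∃ g ∈ X, luxNorm Ψ μ (f - g) < ε) → f ∈ X

/-- A set in a normed space is relatively weakly compact. -/
def RelWeaklyCompact {Y : Type*} [NormedAddCommGroup Y] [NormedSpace ℂ Y] (S : Set Y) : Prop :=
  ∃ K : Set (WeakSpace ℂ Y), IsCompact K ∧ (toWeakSpace ℂ Y) '' S ⊆ K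

/-- The unit ball of a subspace `X` of `L^Ψ` for the Luxemburg norm. -/
def luxUnitBall {Ω : Type*} [MeasurableSpace Ω] (Ψ : ℝ → ℝ) (μ : Measure Ω)
    (X : Submodule ℂ (Ω → ℂ)) : Set X :=
  {f : X | luxNorm Ψ μ (f : Ω → ℂ) ≤ 1}

/-- An operator on a subspace of `L^Ψ` is weakly compact if the image of the unit ball is
relatively weakly compact. -/
def IsWeaklyCompactOp {Ω : Type*} [MeasurableSpace Ω] (Ψ : ℝ → ℝ) (μ : Measure Ω)
    {X : Submodule ℂ (Ω → ℂ)} {Y : Type*} [NormedAddCommGroup Y] [NormedSpace ℂ Y]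
    (T : X →ₗ[ℂ] Y) : Prop :=
  RelWeaklyCompact (⇑T '' luxUnitBall Ψ μ X)

/-- An operator on a subspace of `L^Ψ` is compact if the image of the unit ball is
relatively norm compact. -/
def IsCompactOp {Ω : Type*} [MeasurableSpace Ω] (Ψ : ℝ → ℝ) (μ : Measure Ω)
    {X : Submodule ℂ (Ω → ℂ)} {Y : Type*} [NormedAddCommGroup Y] [NormedSpace ℂ Y]
    (T : X →ₗ[ℂ] Y) : Prop :=
  IsCompact (closure (⇑T '' luxUnitBall Ψ μ X))

/-- `T` fixes a copy of `c₀`: there is a sequence in `X`, equivalent to the canonical basis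
of `c₀`, on whose (closed) span `T` is an isomorphism onto its image. -/
def FixesCopyOfC0 {Ω : Type*} [MeasurableSpace Ω] (Ψ : ℝ → ℝ) (μ : Measure Ω)
    {X : Submodule ℂ (Ω → ℂ)} {Y : Type*} [NormedAddCommGroup Y] [NormedSpace ℂ Y]
    (T : X →ₗ[ℂ] Y) : Prop :=
  ∃ (u : ℕ → X) (a b c : ℝ), 0 < a ∧ 0 < b ∧ 0 < c ∧
    ∀ (co : ℕ → ℂ) (s : Finset ℕ),
      a * (⨆ k ∈ s, ‖co k‖) ≤ luxNorm Ψ μ ((∑ k ∈ s, co k • u k : X) : Ω → ℂ) ∧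
      luxNorm Ψ μ ((∑ k ∈ s, co k • u k : X) : Ω → ℂ) ≤ b * (⨆ k ∈ s, ‖co k‖) ∧
      c * (⨆ k ∈ s, ‖co k‖) ≤ ‖T (∑ k ∈ s, co k • u k)‖

/-- The complementary (conjugate) Orlicz function `Φ(x) = sup_{y ≥ 0} (xy - Ψ(y))`. -/
def complementaryOrlicz (Ψ : ℝ → ℝ) (x : ℝ) : ℝ :=
  sSup ((fun y => x * y - Ψ y) '' Set.Ici (0 : ℝ))

/-- The `Δ₂` condition. -/
def Delta2 (Φ : ℝ → ℝ) : Prop :=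
  ∃ K > 0, ∃ x₀ > 0, ∀ x ≥ x₀, Φ (2 * x) ≤ K * Φ x

/-- The `Δ⁰` condition: for some `β > 1`, `Ψ(βx)/Ψ(x) → ∞` as `x → ∞`. -/
def Delta0 (Ψ : ℝ → ℝ) : Prop :=
  ∃ β > 1, Tendsto (fun x => Ψ (β * x) / Ψ x) atTop atTop

end

noncomputable section

/-- The Dirichlet energy of `f` on the discrete cube of subsets of `s`. -/
def cubeEnergy {ι : Type*} [DecidableEq ι] (s : Finset ι) (f : Finset ι → ℝ) : ℝ :=
  ∑ t ∈ s.powerset, ∑ i ∈ s, (f t - f (symmDiff t {i})) ^ 2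

/-- The sign `+1` on the elements of `t`, and `-1` off `t`. -/
def cubeSign {ι : Type*} [DecidableEq ι] (t : Finset ι) (i : ι) : ℝ := if i ∈ t then 1 else -1

section Cube

variable {ι : Type*} [DecidableEq ι]

lemma cubeSign_eq_or (t : Finset ι) (i : ι) : cubeSign t i = 1 ∨ cubeSign t i = -1 := by
  unfold cubeSign; split_ifs <;> simp

lemma symmDiff_singleton_insert {a i : ι} (h : i ≠ a) (t : Finset ι) :
    symmDiff (insert a t) {i} = insert a (symmDiff t {i}) := by
  ext x; simp only [Finset.mem_symmDiff, Finset.mem_insert, Finset.mem_singleton]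
  grind

lemma symmDiff_singleton_of_notMem {a : ι} {t : Finset ι} (h : a ∉ t) :
    symmDiff t {a} = insert a t := by
  ext x; simp only [Finset.mem_symmDiff, Finset.mem_insert, Finset.mem_singleton]
  grind

lemma symmDiff_insert_singleton {a : ι} {t : Finset ι} (h : a ∉ t) :
    symmDiff (insert a t) {a} = t := by
  ext x; simp only [Finset.mem_symmDiff, Finset.mem_insert, Finset.mem_singleton]
  grind

lemma cubeEnergy_insert {a : ι} {s : Finset ι} (ha : a ∉ s) (f : Finset ι → ℝ) :
    cubeEnergy (insert a s) f = cubeEnergy s f + cubeEnergy s (fun t => f (insert a t)) +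
      2 * ∑ t ∈ s.powerset, (f (insert a t) - f t) ^ 2 := by
  unfold cubeEnergy
  rw [Finset.sum_powerset_insert ha, Finset.mul_sum, ← Finset.sum_add_distrib,
    ← Finset.sum_add_distrib, ← Finset.sum_add_distrib]
  refine Finset.sum_congr rfl fun t ht => ?_
  have hat : a ∉ t := fun h => ha (Finset.mem_powerset.1 ht h)
  rw [Finset.sum_insert ha, Finset.sum_insert ha, symmDiff_singleton_of_notMem hat,
    symmDiff_insert_singleton hat]
  have : ∑ i ∈ s, (f (insert a t) - f (symmDiff (insert a t) {i})) ^ 2 =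
      ∑ i ∈ s, (f (insert a t) - f (insert a (symmDiff t {i}))) ^ 2 :=
    Finset.sum_congr rfl fun i hi => by
      rw [symmDiff_singleton_insert (ne_of_mem_of_not_mem hi ha)]
  rw [this]; ring

lemma cubeEnergy_add_sub (s : Finset ι) (g h : Finset ι → ℝ) :
    cubeEnergy s (fun t => g t - h t) + cubeEnergy s (fun t => g t + h t) =
      2 * cubeEnergy s g + 2 * cubeEnergy s h := by
  simp only [cubeEnergy, Finset.mul_sum, ← Finset.sum_add_distrib]
  refine Finset.sum_congr rfl fun t _ => Finset.sum_congr rfl fun i _ => ?_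
  ring

/-- The Poincaré inequality on the discrete cube. -/
lemma cube_poincare (s : Finset ι) (f : Finset ι → ℝ) :
    4 * ∑ t ∈ s.powerset, f t ^ 2 - 4 * (∑ t ∈ s.powerset, f t) ^ 2 / 2 ^ s.card ≤
      cubeEnergy s f := by
  induction s using Finset.induction_on generalizing f with
  | empty => simp [cubeEnergy]
  | insert a s ha ih =>
    rw [cubeEnergy_insert ha, Finset.sum_powerset_insert ha, Finset.sum_powerset_insert ha,
      Finset.card_insert_of_notMem ha]
    have h0 := ih f
    have h1 := ih fun t => f (insert a t)
    have hcs : (∑ t ∈ s.powerset, (f (insert a t) - f t)) ^ 2 / 2 ^ s.card ≤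
        ∑ t ∈ s.powerset, (f (insert a t) - f t) ^ 2 := by
      rw [div_le_iff₀' (by positivity)]
      simpa using sq_sum_le_card_mul_sum_sq (s := s.powerset) (f := fun t => f (insert a t) - f t)
    rw [Finset.sum_sub_distrib] at hcs
    generalize ∑ t ∈ s.powerset, f t = A at *
    generalize ∑ t ∈ s.powerset, f (insert a t) = B at *
    have : 4 * (A + B) ^ 2 / 2 ^ (s.card + 1) = 4 * A ^ 2 / 2 ^ s.card + 4 * B ^ 2 / 2 ^ s.card
        - 2 * ((B - A) ^ 2 / 2 ^ s.card) := by
      rw [pow_succ]; field_simp; ring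
    linarith

/-- The improved Poincaré inequality on the discrete cube: up to the first level of the
Walsh expansion, the spectral gap doubles. -/
lemma cube_poincare_level_one (s : Finset ι) (f : Finset ι → ℝ) :
    8 * ∑ t ∈ s.powerset, f t ^ 2 - 8 * (∑ t ∈ s.powerset, f t) ^ 2 / 2 ^ s.card
      - 4 * (∑ i ∈ s, (∑ t ∈ s.powerset, cubeSign t i * f t) ^ 2) / 2 ^ s.card ≤
      cubeEnergy s f := by
  induction s using Finset.induction_on generalizing f with
  | empty => simp [cubeEnergy]
  | insert a s ha ih =>
    obtain ⟨g, h, hg, hh⟩ : ∃ g h : Finset ι → ℝ, f = (fun t => g t - h t) ∧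
        (fun t => f (insert a t)) = fun t => g t + h t :=
      ⟨fun t => (f (insert a t) + f t) / 2, fun t => (f (insert a t) - f t) / 2,
        by ext; ring, by ext; ring⟩
    have hg' : ∀ t, f t = g t - h t := fun t => congrFun hg t
    have hh' : ∀ t, f (insert a t) = g t + h t := fun t => congrFun hh t
    have e1 : cubeEnergy s f + cubeEnergy s (fun t => f (insert a t)) =
        2 * cubeEnergy s g + 2 * cubeEnergy s h := by
      rw [hh, hg, cubeEnergy_add_sub]
    have e2 : ∑ i ∈ insert a s, (∑ t ∈ (insert a s).powerset, cubeSign t i * f t) ^ 2 =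
        4 * ∑ i ∈ s, (∑ t ∈ s.powerset, cubeSign t i * g t) ^ 2
          + 4 * (∑ t ∈ s.powerset, h t) ^ 2 := by
      rw [Finset.sum_insert ha, add_comm]
      congr 1
      · rw [Finset.mul_sum]
        refine Finset.sum_congr rfl fun i hi => ?_
        have : ∑ t ∈ (insert a s).powerset, cubeSign t i * f t =
            2 * ∑ t ∈ s.powerset, cubeSign t i * g t := by
          rw [Finset.sum_powerset_insert ha, Finset.mul_sum, ← Finset.sum_add_distrib]
          refine Finset.sum_congr rfl fun t _ => ?_
          have : cubeSign (insert a t) i = cubeSign t i := by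
            simp [cubeSign, ne_of_mem_of_not_mem hi ha]
          rw [this, hg', hh']; ring
        rw [this]; ring
      · have : ∑ t ∈ (insert a s).powerset, cubeSign t a * f t = 2 * ∑ t ∈ s.powerset, h t := by
          rw [Finset.sum_powerset_insert ha, Finset.mul_sum, ← Finset.sum_add_distrib]
          refine Finset.sum_congr rfl fun t ht => ?_
          have hat : a ∉ t := fun h => ha (Finset.mem_powerset.1 ht h)
          rw [hg', hh']; simp [cubeSign, hat]; ring
        rw [this]; ring
    have e3 : ∑ t ∈ (insert a s).powerset, f t = 2 * ∑ t ∈ s.powerset, g t := by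
      rw [Finset.sum_powerset_insert ha, Finset.mul_sum, ← Finset.sum_add_distrib]
      exact Finset.sum_congr rfl fun t _ => by rw [hg', hh']; ring
    have e4 : ∑ t ∈ (insert a s).powerset, f t ^ 2 =
        2 * ∑ t ∈ s.powerset, g t ^ 2 + 2 * ∑ t ∈ s.powerset, h t ^ 2 := by
      rw [Finset.sum_powerset_insert ha, Finset.mul_sum, Finset.mul_sum,
        ← Finset.sum_add_distrib, ← Finset.sum_add_distrib]
      exact Finset.sum_congr rfl fun t _ => by rw [hg', hh']; ring
    have e5 : ∑ t ∈ s.powerset, (f (insert a t) - f t) ^ 2 = 4 * ∑ t ∈ s.powerset, h t ^ 2 := by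
      rw [Finset.mul_sum]
      exact Finset.sum_congr rfl fun t _ => by rw [hh', hg']; ring
    rw [cubeEnergy_insert ha, e1, e2, e3, e4, e5, Finset.card_insert_of_notMem ha]
    have i1 := ih g
    have i2 := cube_poincare s h
    generalize ∑ i ∈ s, (∑ t ∈ s.powerset, cubeSign t i * g t) ^ 2 = W at *
    generalize ∑ t ∈ s.powerset, g t = A at *
    generalize ∑ t ∈ s.powerset, h t = B at *
    have k1 : 8 * (2 * A) ^ 2 / (2 : ℝ) ^ (s.card + 1) = 2 * (8 * A ^ 2 / 2 ^ s.card) := by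
      rw [pow_succ]; field_simp; ring
    have k2 : 4 * (4 * W + 4 * B ^ 2) / (2 : ℝ) ^ (s.card + 1) =
        2 * (4 * W / 2 ^ s.card) + 2 * (4 * B ^ 2 / 2 ^ s.card) := by
      rw [pow_succ]; field_simp; ring
    linarith

lemma sum_powerset_symmDiff {i : ι} {s : Finset ι} (hi : i ∈ s) (f : Finset ι → ℝ) :
    ∑ t ∈ s.powerset, f (symmDiff t {i}) = ∑ t ∈ s.powerset, f t := by
  refine Finset.sum_nbij' (fun t => symmDiff t {i}) (fun t => symmDiff t {i}) ?_ ?_ ?_ ?_ ?_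
  · intro t ht
    simp only [Finset.mem_powerset, Finset.subset_iff, Finset.mem_symmDiff,
      Finset.mem_singleton] at *
    grind
  · intro t ht
    simp only [Finset.mem_powerset, Finset.subset_iff, Finset.mem_symmDiff,
      Finset.mem_singleton] at *
    grind
  · simp
  · simp
  · simp

lemma sum_powerset_sdiff (s : Finset ι) (f : Finset ι → ℝ) :
    ∑ t ∈ s.powerset, f (s \ t) = ∑ t ∈ s.powerset, f t := by
  refine Finset.sum_nbij' (fun t => s \ t) (fun t => s \ t) ?_ ?_ ?_ ?_ ?_
  · simp
  · simp
  · intro t ht; simpa using ht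
  · intro t ht; simpa using ht
  · simp

lemma cubeSign_symmDiff (t : Finset ι) (i j : ι) :
    cubeSign (symmDiff t {i}) j = if j = i then - cubeSign t j else cubeSign t j := by
  simp only [cubeSign, Finset.mem_symmDiff, Finset.mem_singleton]
  grind

lemma cubeSign_sdiff {s : Finset ι} {i : ι} (hi : i ∈ s) (t : Finset ι) :
    cubeSign (s \ t) i = - cubeSign t i := by
  simp only [cubeSign, Finset.mem_sdiff]
  grind

variable {E : Type*} [NormedAddCommGroup E] [InnerProductSpace ℝ E]

lemma sum_powerset_norm_sq (s : Finset ι) (z : ι → E) (c : E) :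
    ∑ t ∈ s.powerset, ‖c + ∑ i ∈ s, cubeSign t i • z i‖ ^ 2 =
      2 ^ s.card * (‖c‖ ^ 2 + ∑ i ∈ s, ‖z i‖ ^ 2) := by
  induction s using Finset.induction_on generalizing c with
  | empty => simp
  | insert a s ha ih =>
    rw [Finset.sum_powerset_insert ha, Finset.card_insert_of_notMem ha, Finset.sum_insert ha]
    have e0 : ∑ t ∈ s.powerset, ‖c + ∑ i ∈ insert a s, cubeSign t i • z i‖ ^ 2 =
        ∑ t ∈ s.powerset, ‖(c - z a) + ∑ i ∈ s, cubeSign t i • z i‖ ^ 2 := by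
      refine Finset.sum_congr rfl fun t ht => ?_
      have hat : a ∉ t := fun h => ha (Finset.mem_powerset.1 ht h)
      rw [Finset.sum_insert ha]
      have : cubeSign t a = -1 := by simp [cubeSign, hat]
      rw [this]; congr 2; module
    have e1 : ∑ t ∈ s.powerset, ‖c + ∑ i ∈ insert a s, cubeSign (insert a t) i • z i‖ ^ 2 =
        ∑ t ∈ s.powerset, ‖(c + z a) + ∑ i ∈ s, cubeSign t i • z i‖ ^ 2 := by
      refine Finset.sum_congr rfl fun t ht => ?_
      have : ∑ i ∈ s, cubeSign (insert a t) i • z i = ∑ i ∈ s, cubeSign t i • z i :=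
        Finset.sum_congr rfl fun i hi => by
          simp [cubeSign, ne_of_mem_of_not_mem hi ha]
      rw [Finset.sum_insert ha, this]
      have : cubeSign (insert a t) a = 1 := by simp [cubeSign]
      rw [this]; congr 2; module
    rw [e0, e1, ih, ih]
    have := parallelogram_law_with_norm ℝ c (z a)
    rw [pow_succ]
    linear_combination (2 : ℝ) ^ s.card * this

/-- The `L¹`–`L²` Khintchine–Kahane inequality with the optimal constant `√2`,
following Latała and Oleszkiewicz. -/
theorem khintchine_sqrt_two (s : Finset ι) (z : ι → E) :
    √(∑ i ∈ s, ‖z i‖ ^ 2) / √2 ≤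
      (∑ t ∈ s.powerset, ‖∑ i ∈ s, cubeSign t i • z i‖) / 2 ^ s.card := by
  set f : Finset ι → ℝ := fun t => ‖∑ i ∈ s, cubeSign t i • z i‖ with hf
  have hf0 : ∀ t, 0 ≤ f t := fun t => norm_nonneg _
  have hsq : ∑ t ∈ s.powerset, f t ^ 2 = 2 ^ s.card * ∑ i ∈ s, ‖z i‖ ^ 2 := by
    simpa using sum_powerset_norm_sq s z 0
  have hW : ∀ i ∈ s, ∑ t ∈ s.powerset, cubeSign t i * f t = 0 := by
    intro i hi
    have h := sum_powerset_sdiff s fun t => cubeSign t i * f t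
    have h' : ∑ t ∈ s.powerset, cubeSign (s \ t) i * f (s \ t) =
        - ∑ t ∈ s.powerset, cubeSign t i * f t := by
      rw [← Finset.sum_neg_distrib]
      refine Finset.sum_congr rfl fun t _ => ?_
      have : f (s \ t) = f t := by
        simp only [hf]
        rw [← norm_neg, ← Finset.sum_neg_distrib]
        congr 1
        exact Finset.sum_congr rfl fun j hj => by rw [cubeSign_sdiff hj]; module
      rw [this, cubeSign_sdiff hi]; ring
    linarith
  have hlow : ∀ t, (s.card - 2 : ℝ) * f t ≤ ∑ i ∈ s, f (symmDiff t {i}) := by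
    intro t
    have key : ∑ i ∈ s, ∑ j ∈ s, cubeSign (symmDiff t {i}) j • z j =
        (s.card - 2 : ℝ) • ∑ j ∈ s, cubeSign t j • z j := by
      have : ∀ i ∈ s, ∑ j ∈ s, cubeSign (symmDiff t {i}) j • z j =
          (∑ j ∈ s, cubeSign t j • z j) - (2 : ℝ) • (cubeSign t i • z i) := by
        intro i hi
        rw [← Finset.add_sum_erase s _ hi, ← Finset.add_sum_erase s (fun j => cubeSign t j • z j) hi]
        have : ∑ j ∈ s.erase i, cubeSign (symmDiff t {i}) j • z j =
            ∑ j ∈ s.erase i, cubeSign t j • z j :=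
          Finset.sum_congr rfl fun j hj => by
            rw [cubeSign_symmDiff, if_neg (Finset.ne_of_mem_erase hj)]
        rw [this, cubeSign_symmDiff, if_pos rfl]
        module
      rw [Finset.sum_congr rfl this, Finset.sum_sub_distrib, ← Finset.smul_sum, Finset.sum_const,
        sub_smul, Nat.cast_smul_eq_nsmul]
    calc (s.card - 2 : ℝ) * f t ≤ |(s.card - 2 : ℝ)| * f t :=
          mul_le_mul_of_nonneg_right (le_abs_self _) (hf0 t)
      _ = ‖∑ i ∈ s, ∑ j ∈ s, cubeSign (symmDiff t {i}) j • z j‖ := by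
          rw [key, norm_smul, Real.norm_eq_abs]
      _ ≤ _ := norm_sum_le _ _
  have hD : cubeEnergy s f ≤ 4 * ∑ t ∈ s.powerset, f t ^ 2 := by
    have e : cubeEnergy s f = (∑ t ∈ s.powerset, ∑ i ∈ s, f t ^ 2) +
        (∑ t ∈ s.powerset, ∑ i ∈ s, f (symmDiff t {i}) ^ 2)
        - 2 * ∑ t ∈ s.powerset, f t * ∑ i ∈ s, f (symmDiff t {i}) := by
      simp only [cubeEnergy, Finset.mul_sum, ← Finset.sum_add_distrib, ← Finset.sum_sub_distrib]
      exact Finset.sum_congr rfl fun t _ => Finset.sum_congr rfl fun i _ => by ring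
    have e' : ∑ t ∈ s.powerset, ∑ i ∈ s, f (symmDiff t {i}) ^ 2 =
        s.card * ∑ t ∈ s.powerset, f t ^ 2 := by
      rw [Finset.sum_comm, Finset.sum_congr rfl fun i hi =>
        sum_powerset_symmDiff hi fun t => f t ^ 2]
      simp
    have e'' : ∑ t ∈ s.powerset, ∑ i ∈ s, f t ^ 2 = s.card * ∑ t ∈ s.powerset, f t ^ 2 := by
      simp [Finset.mul_sum]
    have l : (s.card - 2 : ℝ) * ∑ t ∈ s.powerset, f t ^ 2 ≤
        ∑ t ∈ s.powerset, f t * ∑ i ∈ s, f (symmDiff t {i}) := by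
      rw [Finset.mul_sum]
      refine Finset.sum_le_sum fun t _ => ?_
      nlinarith [mul_le_mul_of_nonneg_left (hlow t) (hf0 t)]
    rw [e, e', e'']; linarith
  have hP := cube_poincare_level_one s f
  have hW' : ∑ i ∈ s, (∑ t ∈ s.powerset, cubeSign t i * f t) ^ 2 = 0 :=
    Finset.sum_eq_zero fun i hi => by rw [hW i hi]; ring
  rw [hW'] at hP
  rw [← Real.sqrt_div' _ (by norm_num)]
  refine Real.sqrt_le_iff.2 ⟨by positivity, ?_⟩
  have h3 : 4 * ∑ t ∈ s.powerset, f t ^ 2 ≤ 8 * (∑ t ∈ s.powerset, f t) ^ 2 / 2 ^ s.card := by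
    simp only [mul_zero, zero_div, sub_zero] at hP; linarith
  rw [hsq, le_div_iff₀ (by positivity)] at h3
  rw [div_pow, le_div_iff₀ (by positivity)]
  linarith

end Cube

section Orlicz

variable {Ω : Type*} [MeasurableSpace Ω] {μ : Measure Ω} {Ψ : ℝ → ℝ}

lemma IsOrliczFunction.continuousOn (hΨ : IsOrliczFunction Ψ) : ContinuousOn Ψ (Ici 0) :=
  hΨ.strictConvexOn.convexOn.continuousOn_Ici hΨ.continuousWithinAt_zero

lemma IsOrliczFunction.continuous_comp_max (hΨ : IsOrliczFunction Ψ) :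
    Continuous fun x => Ψ (max x 0) :=
  hΨ.continuousOn.comp_continuous (by fun_prop) fun x => le_max_right x 0

lemma IsOrliczFunction.aemeasurable_comp (hΨ : IsOrliczFunction Ψ) {g : Ω → ℝ}
    (hg : AEMeasurable g μ) (hg0 : ∀ ω, 0 ≤ g ω) :
    AEMeasurable (fun ω => ENNReal.ofReal (Ψ (g ω))) μ := by
  have h := (hΨ.continuous_comp_max.measurable.comp_aemeasurable hg).ennreal_ofReal
  simpa [Function.comp_def, max_eq_left (hg0 _)] using h

lemma IsOrliczFunction.tendsto_comp (hΨ : IsOrliczFunction Ψ) {u : ℕ → ℝ} {a : ℝ}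
    (hu0 : ∀ n, 0 ≤ u n) (hu : Tendsto u atTop (𝓝 a)) :
    Tendsto (fun n => ENNReal.ofReal (Ψ (u n))) atTop (𝓝 (ENNReal.ofReal (Ψ a))) := by
  have ha : 0 ≤ a := ge_of_tendsto' hu hu0
  have h := (hΨ.continuous_comp_max.tendsto a).comp hu
  refine ENNReal.tendsto_ofReal ?_
  simpa [Function.comp_def, max_eq_left (hu0 _), max_eq_left ha] using h

lemma IsOrliczFunction.map_div_le (hΨ : IsOrliczFunction Ψ) {x k : ℝ} (hx : 0 ≤ x)
    (hk : 1 ≤ k) : Ψ (x / k) ≤ Ψ x / k := by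
  have hk0 : 0 < k := by linarith
  have h := hΨ.strictConvexOn.convexOn.2 (mem_Ici.2 hx) (mem_Ici.2 le_rfl)
    (inv_nonneg.2 hk0.le) (sub_nonneg.2 (inv_le_one_of_one_le₀ hk)) (by ring)
  simp only [smul_eq_mul, mul_zero, add_zero, hΨ.map_zero] at h
  rwa [inv_mul_eq_div, inv_mul_eq_div] at h

lemma orliczModular_antitoneOn (hΨ : IsOrliczFunction Ψ) (f : Ω → ℂ) :
    AntitoneOn (orliczModular Ψ μ f) (Ioi 0) := by
  intro C hC D hD hCD
  have hC : 0 < C := hC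
  have hD : 0 < D := hD
  refine lintegral_mono fun ω => ENNReal.ofReal_le_ofReal (hΨ.mono ?_ ?_ ?_)
  · exact div_nonneg (norm_nonneg _) hD.le
  · exact div_nonneg (norm_nonneg _) hC.le
  · gcongr

lemma memOrlicz_zero (hΨ : IsOrliczFunction Ψ) : MemOrlicz Ψ μ (0 : Ω → ℂ) :=
  ⟨aestronglyMeasurable_const, 1, one_pos, by simp [orliczModular, hΨ.map_zero]⟩

lemma MemOrlicz.add (hΨ : IsOrliczFunction Ψ) {f g : Ω → ℂ} (hf : MemOrlicz Ψ μ f)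
    (hg : MemOrlicz Ψ μ g) : MemOrlicz Ψ μ (f + g) := by
  obtain ⟨hfm, C, hC, hfC⟩ := hf
  obtain ⟨hgm, D, hD, hgD⟩ := hg
  refine ⟨hfm.add hgm, C + D, by positivity, ?_⟩
  refine lt_of_le_of_lt ?_ (ENNReal.add_lt_top.2 ⟨hfC, hgD⟩)
  have hm : AEMeasurable (fun ω => ENNReal.ofReal (Ψ (‖f ω‖ / C))) μ :=
    hΨ.aemeasurable_comp (hfm.norm.aemeasurable.div_const C) fun ω => by positivity
  unfold orliczModular
  rw [← lintegral_add_left' hm]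
  refine lintegral_mono fun ω => ?_
  have hmax : ‖(f + g) ω‖ / (C + D) ≤ max (‖f ω‖ / C) (‖g ω‖ / D) := by
    rw [div_le_iff₀ (by positivity), mul_add]
    refine (norm_add_le _ _).trans (add_le_add ?_ ?_)
    · rw [← div_le_iff₀ hC]; exact le_max_left _ _
    · rw [← div_le_iff₀ hD]; exact le_max_right _ _
  rcases max_choice (‖f ω‖ / C) (‖g ω‖ / D) with h | h <;> rw [h] at hmax
  · exact (ENNReal.ofReal_le_ofReal (hΨ.mono (mem_Ici.2 (by positivity))
      (mem_Ici.2 (by positivity)) hmax)).trans le_self_add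
  · exact (ENNReal.ofReal_le_ofReal (hΨ.mono (mem_Ici.2 (by positivity))
      (mem_Ici.2 (by positivity)) hmax)).trans le_add_self

lemma MemOrlicz.smul_of_norm_eq_one {f : Ω → ℂ} (hf : MemOrlicz Ψ μ f) {c : ℂ}
    (hc : ‖c‖ = 1) : MemOrlicz Ψ μ (c • f) := by
  obtain ⟨hfm, C, hC, hfC⟩ := hf
  exact ⟨hfm.const_smul c, C, hC, by simpa [orliczModular, hc] using hfC⟩

lemma memOrlicz_sum (hΨ : IsOrliczFunction Ψ) {ι : Type*} (s : Finset ι) {f : ι → Ω → ℂ}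
    (hf : ∀ i ∈ s, MemOrlicz Ψ μ (f i)) : MemOrlicz Ψ μ (∑ i ∈ s, f i) :=
  Finset.sum_induction f (MemOrlicz Ψ μ) (fun _ _ => MemOrlicz.add hΨ) (memOrlicz_zero hΨ) hf

lemma MemOrlicz.exists_orliczModular_le_one (hΨ : IsOrliczFunction Ψ) {f : Ω → ℂ}
    (hf : MemOrlicz Ψ μ f) : ∃ C, 0 < C ∧ orliczModular Ψ μ f C ≤ 1 := by
  obtain ⟨-, C, hC, hfC⟩ := hf
  set k : ℝ := max 1 (orliczModular Ψ μ f C).toReal with hk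
  have hk1 : 1 ≤ k := le_max_left _ _
  have hk0 : 0 < k := by linarith
  refine ⟨C * k, by positivity, ?_⟩
  calc orliczModular Ψ μ f (C * k)
      ≤ ∫⁻ ω, ENNReal.ofReal k⁻¹ * ENNReal.ofReal (Ψ (‖f ω‖ / C)) ∂μ := by
        refine lintegral_mono fun ω => ?_
        rw [← ENNReal.ofReal_mul (by positivity), ← div_div, inv_mul_eq_div]
        exact ENNReal.ofReal_le_ofReal (hΨ.map_div_le (by positivity) hk1)
    _ = ENNReal.ofReal k⁻¹ * orliczModular Ψ μ f C :=
        lintegral_const_mul' _ _ ENNReal.ofReal_ne_top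
    _ ≤ ENNReal.ofReal k⁻¹ * ENNReal.ofReal k := by
        gcongr
        exact ENNReal.le_ofReal_iff_toReal_le hfC.ne hk0.le |>.2 (le_max_right _ _)
    _ = 1 := by
        rw [← ENNReal.ofReal_mul (by positivity), inv_mul_cancel₀ hk0.ne', ENNReal.ofReal_one]

/-- The infimum defining the Luxemburg norm is attained. -/
lemma MemOrlicz.orliczModular_le_one (hΨ : IsOrliczFunction Ψ) {f : Ω → ℂ}
    (hf : MemOrlicz Ψ μ f) {M : ℝ} (hM : 0 < M) (h : luxNorm Ψ μ f ≤ M) :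
    orliczModular Ψ μ f M ≤ 1 := by
  have hgt : ∀ C, M < C → orliczModular Ψ μ f C ≤ 1 := by
    intro C hC
    obtain ⟨D, ⟨hD, hD1⟩, hDC⟩ :=
      exists_lt_of_csInf_lt (hf.exists_orliczModular_le_one hΨ) (h.trans_lt hC)
    exact (orliczModular_antitoneOn hΨ f hD (hM.trans hC) hDC.le).trans hD1
  have hlim : Tendsto (fun n : ℕ => M + 1 / ((n : ℝ) + 1)) atTop (𝓝 M) := by
    simpa using tendsto_one_div_add_atTop_nhds_zero_nat.const_add M
  have hpos : ∀ n : ℕ, 0 < M + 1 / ((n : ℝ) + 1) := fun n => by positivity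
  calc orliczModular Ψ μ f M
      = ∫⁻ ω, liminf (fun n : ℕ =>
          ENNReal.ofReal (Ψ (‖f ω‖ / (M + 1 / ((n : ℝ) + 1))))) atTop ∂μ := by
        refine lintegral_congr fun ω => ?_
        refine (Tendsto.liminf_eq (hΨ.tendsto_comp ?_ ?_)).symm
        · exact fun n => div_nonneg (norm_nonneg _) (hpos n).le
        · exact tendsto_const_nhds.div hlim hM.ne'
    _ ≤ liminf (fun n : ℕ => orliczModular Ψ μ f (M + 1 / ((n : ℝ) + 1))) atTop :=
        lintegral_liminf_le' fun n => hΨ.aemeasurable_comp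
          (hf.1.norm.aemeasurable.div_const _) fun ω => div_nonneg (norm_nonneg _) (hpos n).le
    _ ≤ liminf (fun _ : ℕ => (1 : ℝ≥0∞)) atTop :=
        liminf_le_liminf (Eventually.of_forall fun n => hgt _ (by
          have : (0 : ℝ) < 1 / ((n : ℝ) + 1) := by positivity
          linarith))
    _ = 1 := by simp

/-- A finite form of the square function estimate. -/
lemma lintegral_squareFunction_le_one (hΨ : IsOrliczFunction Ψ) {f : ℕ → Ω → ℂ}
    (hf : ∀ n, MemOrlicz Ψ μ (f n)) {M : ℝ} (hM : 0 < M) (N : ℕ)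
    (hbound : ∀ ε : ℕ → ℝ, (∀ n, ε n = 1 ∨ ε n = -1) →
      luxNorm Ψ μ (∑ n ∈ Finset.range N, (ε n : ℂ) • f n) ≤ M) :
    ∫⁻ ω, ENNReal.ofReal (Ψ (√(∑ n ∈ Finset.range N, ‖f n ω‖ ^ 2) / (M * √2))) ∂μ ≤ 1 := by
  set s := Finset.range N
  set X : Finset ℕ → Ω → ℂ := fun t => ∑ n ∈ s, (cubeSign t n : ℂ) • f n with hX
  have hXmem : ∀ t, MemOrlicz Ψ μ (X t) := fun t => memOrlicz_sum hΨ s fun i _ =>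
    (hf i).smul_of_norm_eq_one (by rcases cubeSign_eq_or t i with h | h <;> simp [h])
  have hX1 : ∀ t, orliczModular Ψ μ (X t) M ≤ 1 := fun t =>
    (hXmem t).orliczModular_le_one hΨ hM (hbound _ (cubeSign_eq_or t))
  have hpt : ∀ ω, ENNReal.ofReal (Ψ (√(∑ n ∈ s, ‖f n ω‖ ^ 2) / (M * √2))) ≤
      ENNReal.ofReal (2 ^ s.card)⁻¹ *
        ∑ t ∈ s.powerset, ENNReal.ofReal (Ψ (‖X t ω‖ / M)) := by
    intro ω
    rw [← ENNReal.ofReal_sum_of_nonneg fun t _ => hΨ.nonneg _,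
      ← ENNReal.ofReal_mul (by positivity)]
    refine ENNReal.ofReal_le_ofReal ?_
    have hk := khintchine_sqrt_two s fun n => f n ω
    have hXω : ∀ t, ∑ n ∈ s, cubeSign t n • f n ω = X t ω := fun t => by simp [hX]
    simp only [hXω] at hk
    have hj := hΨ.strictConvexOn.convexOn.map_sum_le (t := s.powerset)
      (w := fun _ => ((2 : ℝ) ^ s.card)⁻¹) (p := fun t => ‖X t ω‖ / M)
      (fun _ _ => by positivity) (by simp) (fun t _ => mem_Ici.2 (by positivity))
    simp only [smul_eq_mul, ← Finset.mul_sum] at hj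
    refine le_trans (hΨ.mono (mem_Ici.2 (by positivity)) (mem_Ici.2 (by positivity)) ?_) hj
    rw [← Finset.sum_div, mul_comm M, ← div_div, ← mul_div_assoc, inv_mul_eq_div]
    gcongr
  calc _ ≤ ∫⁻ ω, ENNReal.ofReal (2 ^ s.card)⁻¹ *
        ∑ t ∈ s.powerset, ENNReal.ofReal (Ψ (‖X t ω‖ / M)) ∂μ := lintegral_mono hpt
    _ = ENNReal.ofReal (2 ^ s.card)⁻¹ * ∑ t ∈ s.powerset, orliczModular Ψ μ (X t) M := by
        rw [lintegral_const_mul' _ _ ENNReal.ofReal_ne_top, lintegral_finsetSum']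
        · rfl
        · exact fun t _ => hΨ.aemeasurable_comp ((hXmem t).1.norm.aemeasurable.div_const _)
            fun ω => by positivity
    _ ≤ ENNReal.ofReal (2 ^ s.card)⁻¹ * ∑ t ∈ s.powerset, 1 := by
        gcongr with t; exact hX1 t
    _ = 1 := by
        rw [Finset.sum_const, Finset.card_powerset, nsmul_eq_mul, mul_one, Nat.cast_pow,
          Nat.cast_ofNat, ENNReal.ofReal_inv_of_pos (by positivity),
          ENNReal.ofReal_pow (by norm_num), ENNReal.ofReal_ofNat]
        exact ENNReal.inv_mul_cancel (by positivity) (by finiteness)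

end Orlicz

/-- If `(f_n) ⊂ L^Ψ` satisfies `‖∑_{n<N} ε_n f_n‖_Ψ ≤ M` for all `N` and all signs
`ε_n = ±1`, then `∫ Ψ((∑ |f_n|²)^{1/2}/(M√2)) dP ≤ 1`; in particular `f_n → 0` a.e. and
`∫ Ψ(|f_n|/(M√2)) dP → 0`. -/
theorem statement10 {Ω : Type*} [MeasurableSpace Ω] (μ : Measure Ω) [IsProbabilityMeasure μ]
    {Ψ : ℝ → ℝ} (hΨ : IsOrliczFunction Ψ)
    (f : ℕ → Ω → ℂ) (hf : ∀ n, MemOrlicz Ψ μ (f n)) (M : ℝ) (hM : 0 < M)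
    (hbound : ∀ (N : ℕ) (ε : ℕ → ℝ), (∀ n, ε n = 1 ∨ ε n = -1) →
      luxNorm Ψ μ (∑ n ∈ Finset.range N, (ε n : ℂ) • f n) ≤ M) :
    (∀ᵐ ω ∂μ, Summable fun n => ‖f n ω‖ ^ 2) ∧
    (∫⁻ ω, ENNReal.ofReal
        (Ψ (Real.sqrt (∑' n, ‖f n ω‖ ^ 2) / (M * Real.sqrt 2))) ∂μ) ≤ 1 ∧
    (∀ᵐ ω ∂μ, Tendsto (fun n => f n ω) atTop (𝓝 0)) ∧
    Tendsto (fun n => orliczModular Ψ μ (f n) (M * Real.sqrt 2)) atTop (𝓝 0) := by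
  have hc : 0 < M * √2 := by positivity
  set S : ℕ → Ω → ℝ := fun N ω => √(∑ n ∈ Finset.range N, ‖f n ω‖ ^ 2) / (M * √2) with hS
  set G : ℕ → Ω → ℝ≥0∞ := fun N ω => ENNReal.ofReal (Ψ (S N ω)) with hG
  have hS0 : ∀ N ω, 0 ≤ S N ω := fun N ω => by positivity
  have hSm : ∀ N, AEMeasurable (S N) μ := fun N =>
    (Finset.aemeasurable_fun_sum _ fun n _ =>
      (hf n).1.norm.aemeasurable.pow_const 2).sqrt.div_const _
  have hGm : ∀ N, AEMeasurable (G N) μ := fun N => hΨ.aemeasurable_comp (hSm N) (hS0 N)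
  have hSmono : ∀ ω, Monotone fun N => S N ω := by
    intro ω N N' h
    simp only [hS]
    gcongr
  have hGmono : ∀ ω, Monotone fun N => G N ω := fun ω N N' h =>
    ENNReal.ofReal_le_ofReal (hΨ.mono (hS0 N ω) (hS0 N' ω) (hSmono ω h))
  have hsup : ∫⁻ ω, ⨆ N, G N ω ∂μ ≤ 1 := by
    rw [lintegral_iSup' hGm (Eventually.of_forall hGmono)]
    exact iSup_le fun N => lintegral_squareFunction_le_one hΨ hf hM N (hbound N)
  have hfin : ∀ᵐ ω ∂μ, ⨆ N, G N ω < ⊤ :=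
    ae_lt_top' (.iSup hGm) (hsup.trans_lt ENNReal.one_lt_top).ne
  have hsum : ∀ᵐ ω ∂μ, Summable fun n => ‖f n ω‖ ^ 2 := by
    filter_upwards [hfin] with ω hω
    obtain ⟨x₀, hx₀⟩ := eventually_atTop.1
      ((hΨ.tendsto_div_atTop.eventually_ge_atTop 1).and (eventually_gt_atTop 0))
    set K := max x₀ (⨆ N, G N ω).toReal with hK
    have hSK : ∀ N, S N ω ≤ K := by
      intro N
      rcases le_total (S N ω) x₀ with h | h
      · exact h.trans (le_max_left _ _)
      · obtain ⟨h1, h2⟩ := hx₀ _ h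
        rw [le_div_iff₀ h2, one_mul] at h1
        refine h1.trans (le_trans ?_ (le_max_right _ _))
        exact (ENNReal.ofReal_le_iff_le_toReal hω.ne).1 (le_iSup (fun N => G N ω) N)
    refine summable_of_sum_range_le (c := (K * (M * √2)) ^ 2) (fun n => by positivity) fun N => ?_
    have hK0 : 0 ≤ K * (M * √2) := mul_nonneg ((hS0 0 ω).trans (hSK 0)) hc.le
    exact (Real.sqrt_le_left hK0).1 ((div_le_iff₀ hc).1 (hSK N))
  have hle : ∫⁻ ω, ENNReal.ofReal (Ψ (√(∑' n, ‖f n ω‖ ^ 2) / (M * √2))) ∂μ ≤ 1 := by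
    refine (lintegral_mono_ae ?_).trans hsup
    filter_upwards [hsum] with ω hω
    refine le_of_tendsto' (hΨ.tendsto_comp (fun N => hS0 N ω) ?_) fun N => le_iSup (fun N => G N ω) N
    exact (hω.hasSum.tendsto_sum_nat.sqrt).div_const _
  have hzero : ∀ᵐ ω ∂μ, Tendsto (fun n => f n ω) atTop (𝓝 0) := by
    filter_upwards [hsum] with ω hω
    rw [tendsto_zero_iff_norm_tendsto_zero]
    simpa using hω.tendsto_atTop_zero.sqrt
  refine ⟨hsum, hle, hzero, ?_⟩
  have hdom := tendsto_lintegral_of_dominated_convergence' (μ := μ)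
    (F := fun n ω => ENNReal.ofReal (Ψ (‖f n ω‖ / (M * √2)))) (f := fun _ => 0)
    (fun ω => ENNReal.ofReal (Ψ (√(∑' n, ‖f n ω‖ ^ 2) / (M * √2))))
    (fun n => hΨ.aemeasurable_comp ((hf n).1.norm.aemeasurable.div_const _)
      fun ω => by positivity)
    (fun n => by
      filter_upwards [hsum] with ω hω
      refine ENNReal.ofReal_le_ofReal (hΨ.mono (mem_Ici.2 (by positivity))
        (mem_Ici.2 (by positivity)) ?_)
      gcongr
      exact Real.le_sqrt_of_sq_le (hω.le_tsum n fun _ _ => by positivity))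
    (hle.trans_lt ENNReal.one_lt_top).ne
    (by
      filter_upwards [hzero] with ω hω
      have h := hΨ.tendsto_comp (u := fun n => ‖f n ω‖ / (M * √2)) (fun n => by positivity)
        (hω.norm.div_const _)
      simpa [hΨ.map_zero] using h)
  simpa [orliczModular] using hdom

end
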